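/- Let 0 < α < 1, λ > 0, μ > 0, T > 0, and set ν = μ/(1+λ). Suppose C and f are real constants such that the function u(t) = f/μ + C · E_{α,1}(−ν t^α) satisfies u(0) = 0 and u(T) = 0. Then C = 0, f = 0, and u(t) = 0 for all t ∈ [0, T]. -/

import Mathlib

/-- The Mittag-Leffler function `E_{α,β}(z) = ∑_{m=0}^∞ z^m / Γ(α m + β)`. -/
noncomputable def mittagLeffler (α β z : ℝ) : ℝ :=
  ∑' m : ℕ, z ^ m / Real.Gamma (α * m + β)

open Set Filter Topology MeasureTheory

lemma ker_int (α t a b : ℝ) (hα : 0 < α) :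
    IntervalIntegrable (fun s : ℝ => (t - s) ^ (α - 1)) volume a b := by
  have h : IntervalIntegrable (fun s : ℝ => s ^ (α - 1)) volume (t - a) (t - b) :=
    intervalIntegral.intervalIntegrable_rpow' (by linarith)
  have := h.comp_sub_left t
  simpa using this

lemma ker_val (α t a : ℝ) (hα : 0 < α) :
    ∫ s in a..t, (t - s) ^ (α - 1) = (t - a) ^ α / α := by
  rw [intervalIntegral.integral_comp_sub_left (fun s : ℝ => s ^ (α - 1)) t,
    integral_rpow (Or.inl (by linarith))]
  simp [Real.zero_rpow hα.ne']

lemma no_return (α c T : ℝ) (hα : 0 < α) (hα1 : α < 1) (hc : 0 < c) (hT : 0 < T)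
    (g : ℝ → ℝ) (hg : ContinuousOn g (Icc 0 T)) (g0 : g 0 = 1)
    (hV : ∀ t, 0 < t → t ≤ T → g t = 1 - c * ∫ s in (0:ℝ)..t, (t - s) ^ (α - 1) * g s) :
    g T ≠ 1 := by
  intro gT
  obtain ⟨P, hP0, hPT, hM1, hmax⟩ : ∃ P, 0 < P ∧ P ≤ T ∧ 1 ≤ g P ∧ ∀ s ∈ Icc 0 P, g s ≤ g P := by
    obtain ⟨x, hx, hxm⟩ := isCompact_Icc.exists_isMaxOn (nonempty_Icc.2 hT.le) hg
    have hxm' : ∀ s ∈ Icc 0 T, g s ≤ g x := fun s hs => hxm hs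
    rcases hx.1.eq_or_lt with h | h
    · refine ⟨T, hT, le_rfl, gT.ge, fun s hs => ?_⟩
      have := hxm' s hs
      rw [← h, g0] at this
      rwa [gT]
    · exact ⟨x, h, hx.2, g0 ▸ hxm' 0 ⟨le_rfl, hT.le⟩,
        fun s hs => hxm' s ⟨hs.1, hs.2.trans hx.2⟩⟩
  obtain ⟨a, ha0, haP, hac⟩ : ∃ a, 0 < a ∧ a < P ∧ c * ((P - a) ^ α / α) < 1 := by
    have hcont : Tendsto (fun a : ℝ => c * ((P - a) ^ α / α)) (𝓝[<] P) (𝓝 0) := by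
      have : ContinuousAt (fun a : ℝ => c * ((P - a) ^ α / α)) P := by
        refine continuousAt_const.mul (ContinuousAt.div_const ?_ _)
        exact (continuousAt_const.sub continuousAt_id).rpow_const (Or.inr hα.le)
      have h2 := this.tendsto
      simp only [sub_self, Real.zero_rpow hα.ne', zero_div, mul_zero] at h2
      exact h2.mono_left nhdsWithin_le_nhds
    have e1 := hcont.eventually_lt_const (show (0:ℝ) < 1 by norm_num)
    have e2 : ∀ᶠ a in 𝓝[<] P, a ∈ Ioo 0 P := Ioo_mem_nhdsLT hP0
    obtain ⟨a, h1, h2⟩ := (e1.and e2).exists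
    exact ⟨a, h2.1, h2.2, h1⟩
  obtain ⟨t, hat, htP, hmin⟩ : ∃ t, a ≤ t ∧ t < P ∧ ∀ s ∈ Icc a P, g t ≤ g s := by
    obtain ⟨x, hx, hxm⟩ := isCompact_Icc.exists_isMinOn (nonempty_Icc.2 haP.le)
      (hg.mono (Icc_subset_Icc ha0.le hPT))
    have hxm' : ∀ s ∈ Icc a P, g x ≤ g s := fun s hs => hxm hs
    rcases hx.2.eq_or_lt with h | h
    · refine ⟨a, le_rfl, haP, fun s hs => ?_⟩
      have h1 := hxm' s hs
      rw [h] at h1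
      exact (hmax a ⟨ha0.le, haP.le⟩).trans h1
    · exact ⟨x, hx.1, h, hxm'⟩
  have ht0 : 0 < t := ha0.trans_le hat
  set M := g P with hM
  have hgc : ∀ {x y : ℝ}, 0 ≤ x → x ≤ y → y ≤ P → ContinuousOn g (uIcc x y) := by
    intro x y h1 h2 h3
    rw [uIcc_of_le h2]
    exact hg.mono (Icc_subset_Icc h1 (h3.trans hPT))
  have hint : ∀ {x y : ℝ} (r : ℝ), 0 ≤ x → x ≤ y → y ≤ P →
      IntervalIntegrable (fun s => (r - s) ^ (α - 1) * (M - g s)) volume x y := by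
    intro x y r h1 h2 h3
    exact (ker_int α r x y hα).mul_continuousOn (continuousOn_const.sub (hgc h1 h2 h3))
  have key : ∀ r, 0 < r → r ≤ P →
      g r = 1 - c * (M * (r ^ α / α) - ∫ s in (0:ℝ)..r, (r - s) ^ (α - 1) * (M - g s)) := by
    intro r h1 h2
    rw [hV r h1 (h2.trans hPT)]
    congr 2
    have hk := ker_val α r 0 hα
    rw [sub_zero] at hk
    rw [← hk, ← intervalIntegral.integral_const_mul, ← intervalIntegral.integral_sub
      ((ker_int α r 0 r hα).const_mul M) (hint r le_rfl h1.le h2)]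
    congr 1
    ext s
    ring
  have kP := key P hP0 le_rfl
  have kt := key t ht0 htP.le
  have split := intervalIntegral.integral_add_adjacent_intervals
    (hint P le_rfl ht0.le htP.le) (hint P ht0.le htP.le le_rfl)
  have i1 : ∫ s in (0:ℝ)..t, (P - s) ^ (α - 1) * (M - g s) ≤
      ∫ s in (0:ℝ)..t, (t - s) ^ (α - 1) * (M - g s) := by
    refine intervalIntegral.integral_mono_on_of_le_Ioo ht0.le (hint P le_rfl ht0.le htP.le)
      (hint t le_rfl ht0.le htP.le) fun s hs => ?_
    refine mul_le_mul_of_nonneg_right ?_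
      (sub_nonneg.2 (hmax s ⟨hs.1.le, hs.2.le.trans htP.le⟩))
    exact Real.rpow_le_rpow_of_nonpos (sub_pos.2 hs.2) (by linarith) (by linarith)
  have i2 : ∫ s in t..P, (P - s) ^ (α - 1) * (M - g s) ≤ (P - t) ^ α / α * (M - g t) := by
    rw [← ker_val α P t hα, ← intervalIntegral.integral_mul_const]
    refine intervalIntegral.integral_mono_on_of_le_Ioo htP.le (hint P ht0.le htP.le le_rfl)
      ((ker_int α P t P hα).mul_const _) fun s hs => ?_
    refine mul_le_mul_of_nonneg_left ?_ (Real.rpow_nonneg (by linarith [hs.2]) _)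
    linarith [hmin s ⟨hat.trans hs.1.le, hs.2.le⟩]
  have hy : 0 ≤ M - g t := sub_nonneg.2 (hmax t ⟨ht0.le, htP.le⟩)
  have hlt : t ^ α / α < P ^ α / α :=
    div_lt_div_of_pos_right (Real.rpow_lt_rpow ht0.le htP hα) hα
  have hle : c * ((P - t) ^ α / α) ≤ 1 := by
    refine le_trans ?_ hac.le
    have : (P - t) ^ α ≤ (P - a) ^ α := Real.rpow_le_rpow (by linarith) (by linarith) hα.le
    gcongr
  have f1 : c * ((P - t) ^ α / α) * (M - g t) ≤ 1 * (M - g t) := mul_le_mul_of_nonneg_right hle hy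
  have f2 : c * M * (t ^ α / α) < c * M * (P ^ α / α) :=
    mul_lt_mul_of_pos_left hlt (mul_pos hc (by linarith))
  have f3 := mul_le_mul_of_nonneg_left (split.symm.le.trans (add_le_add i1 i2)) hc.le
  rw [← hM] at kP
  nlinarith

lemma gamma_ratio (α x : ℝ) (hα : 0 < α) (hx : 1 < x) :
    (x - 1) ^ α * Real.Gamma x ≤ Real.Gamma (x + α) := by
  have h := Real.convexOn_log_Gamma.slope_mono_adjacent (x := x - 1) (y := x) (z := x + α)
    (by simp; linarith) (by simp; linarith) (by linarith) (by linarith)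
  have g1 : Real.Gamma x = (x - 1) * Real.Gamma (x - 1) := by
    have := Real.Gamma_add_one (s := x - 1) (by linarith)
    simpa using this
  have p1 : 0 < Real.Gamma (x - 1) := Real.Gamma_pos_of_pos (by linarith)
  have p2 : 0 < Real.Gamma x := Real.Gamma_pos_of_pos (by linarith)
  have p3 : 0 < Real.Gamma (x + α) := Real.Gamma_pos_of_pos (by linarith)
  have q : 0 < x - 1 := by linarith
  have hl : Real.log (Real.Gamma x) = Real.log (x - 1) + Real.log (Real.Gamma (x - 1)) := by
    rw [g1, Real.log_mul q.ne' p1.ne']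
  simp only [Function.comp, sub_sub_cancel, div_one, add_sub_cancel_left] at h
  rw [le_div_iff₀ hα] at h
  rw [← Real.log_le_log_iff (by positivity) p3, Real.log_mul (by positivity) p2.ne',
    Real.log_rpow q]
  have : Real.log (Real.Gamma x) - Real.log (Real.Gamma (x - 1)) = Real.log (x - 1) := by
    linarith
  rw [this] at h
  linarith

lemma ml_summable (α z : ℝ) (hα : 0 < α) :
    Summable (fun m : ℕ => z ^ m / Real.Gamma (α * m + 1)) := by
  refine summable_of_ratio_norm_eventually_le (r := 1 / 2) (by norm_num) ?_
  have ht : Tendsto (fun m : ℕ => (α * (m : ℝ)) ^ α) atTop atTop :=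
    (tendsto_rpow_atTop hα).comp (tendsto_natCast_atTop_atTop.const_mul_atTop hα)
  filter_upwards [ht.eventually_ge_atTop (2 * |z|), eventually_gt_atTop 0] with m hm hm0
  have hm0' : (0:ℝ) < m := by exact_mod_cast hm0
  have hx : 1 < α * m + 1 := by have := mul_pos hα hm0'; linarith
  have h := gamma_ratio α (α * m + 1) hα hx
  have p2 : 0 < Real.Gamma (α * m + 1) := Real.Gamma_pos_of_pos (by linarith)
  have e : α * ((m + 1 : ℕ) : ℝ) + 1 = α * m + 1 + α := by push_cast; ring
  have p3 : 0 < Real.Gamma (α * m + 1 + α) := Real.Gamma_pos_of_pos (by linarith)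
  rw [e, norm_div, norm_div, norm_pow, norm_pow, Real.norm_of_nonneg p2.le,
    Real.norm_of_nonneg p3.le, Real.norm_eq_abs, ← mul_div_assoc, div_le_div_iff₀ p3 p2, pow_succ]
  have h3 : 2 * |z| * Real.Gamma (α * m + 1) ≤ Real.Gamma (α * m + 1 + α) := by
    refine le_trans (mul_le_mul_of_nonneg_right hm p2.le) ?_
    simpa using h
  have := mul_le_mul_of_nonneg_left h3 (pow_nonneg (abs_nonneg z) m)
  linarith

lemma beta_real (a b t : ℝ) (ha : 0 < a) (hb : 0 < b) (ht : 0 < t) :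
    ∫ s in (0:ℝ)..t, (t - s) ^ (b - 1) * s ^ (a - 1) =
      t ^ (a + b - 1) * (Real.Gamma a * Real.Gamma b / Real.Gamma (a + b)) := by
  have h := Complex.betaIntegral_scaled a b ht
  rw [Complex.betaIntegral_eq_Gamma_mul_div _ _ (by simpa) (by simpa)] at h
  have h2 : ∫ x in (0:ℝ)..t, (x : ℂ) ^ ((a:ℂ) - 1) * ((t : ℂ) - x) ^ ((b:ℂ) - 1) =
      ∫ x in (0:ℝ)..t, (((t - x) ^ (b - 1) * x ^ (a - 1) : ℝ) : ℂ) := by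
    refine intervalIntegral.integral_congr fun x hx => ?_
    rw [uIcc_of_le ht.le] at hx
    rw [Complex.ofReal_mul, Complex.ofReal_cpow hx.1, Complex.ofReal_cpow (sub_nonneg.2 hx.2)]
    push_cast
    ring
  rw [h2, intervalIntegral.integral_ofReal] at h
  rw [← Complex.ofReal_inj, h, Complex.ofReal_mul, Complex.ofReal_cpow ht.le]
  simp only [← Complex.ofReal_add, Complex.Gamma_ofReal]
  push_cast
  ring

lemma ml_term (α ν s : ℝ) (m : ℕ) (hs : 0 ≤ s) :
    (-ν * s ^ α) ^ m / Real.Gamma (α * m + 1) =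
      (-ν) ^ m / Real.Gamma (α * m + 1) * s ^ (α * m + 1 - 1) := by
  rw [mul_pow, add_sub_cancel_right, Real.rpow_mul hs, Real.rpow_natCast]
  ring

lemma ml_bound (α ν T s : ℝ) (m : ℕ) (hα : 0 < α) (hν : 0 < ν) (hs : 0 ≤ s) (hsT : s ≤ T) :
    ‖(-ν * s ^ α) ^ m / Real.Gamma (α * m + 1)‖ ≤ (ν * T ^ α) ^ m / Real.Gamma (α * m + 1) := by
  have p2 : 0 < Real.Gamma (α * m + 1) := Real.Gamma_pos_of_pos (by positivity)
  rw [norm_div, norm_pow, norm_mul, norm_neg, Real.norm_of_nonneg p2.le, Real.norm_of_nonneg hν.le,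
    Real.norm_of_nonneg (Real.rpow_nonneg hs _)]
  have := Real.rpow_le_rpow hs hsT hα.le
  have := Real.rpow_nonneg hs α
  gcongr

lemma ml_continuousOn (α ν T : ℝ) (hα : 0 < α) (hν : 0 < ν) :
    ContinuousOn (fun t : ℝ => mittagLeffler α 1 (-ν * t ^ α)) (Icc 0 T) := by
  unfold mittagLeffler
  refine continuousOn_tsum (u := fun m : ℕ => (ν * T ^ α) ^ m / Real.Gamma (α * m + 1)) ?_
    (ml_summable α _ hα) fun m s hs => ml_bound α ν T s m hα hν hs.1 hs.2
  intro m
  have : Continuous (fun x : ℝ => x ^ α) := Real.continuous_rpow_const hα.le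
  fun_prop

lemma ml_volterra (α ν t : ℝ) (hα : 0 < α) (hν : 0 < ν) (ht : 0 < t) :
    mittagLeffler α 1 (-ν * t ^ α) = 1 - ν / Real.Gamma α *
      ∫ s in (0:ℝ)..t, (t - s) ^ (α - 1) * mittagLeffler α 1 (-ν * s ^ α) := by
  have pα := Real.Gamma_pos_of_pos hα
  have hS : HasSum
      (fun m : ℕ => ∫ s in (0:ℝ)..t, (t - s) ^ (α - 1) *
        ((-ν * s ^ α) ^ m / Real.Gamma (α * m + 1)))
      (∫ s in (0:ℝ)..t, (t - s) ^ (α - 1) * mittagLeffler α 1 (-ν * s ^ α)) := by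
    refine intervalIntegral.hasSum_integral_of_dominated_convergence
      (fun (m : ℕ) s => (t - s) ^ (α - 1) * ((ν * t ^ α) ^ m / Real.Gamma (α * m + 1)))
      ?_ ?_ ?_ ?_ ?_
    · intro m
      apply Measurable.aestronglyMeasurable
      fun_prop
    · intro m
      refine Eventually.of_forall fun s hs => ?_
      rw [uIoc_of_le ht.le] at hs
      have h0 := Real.rpow_nonneg (sub_nonneg.2 hs.2) (α - 1)
      rw [norm_mul, Real.norm_of_nonneg h0]
      exact mul_le_mul_of_nonneg_left (ml_bound α ν t s m hα hν hs.1.le hs.2) h0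
    · exact Eventually.of_forall fun s hs => (ml_summable α _ hα).mul_left _
    · simp_rw [tsum_mul_left]
      exact (ker_int α t 0 t hα).mul_const _
    · exact Eventually.of_forall fun s hs => ((ml_summable α _ hα).hasSum).mul_left _
  have hterm : ∀ m : ℕ, ∫ s in (0:ℝ)..t, (t - s) ^ (α - 1) *
        ((-ν * s ^ α) ^ m / Real.Gamma (α * m + 1)) =
      -(Real.Gamma α / ν) *
        ((-ν * t ^ α) ^ (m + 1) / Real.Gamma (α * ((m + 1 : ℕ) : ℝ) + 1)) := by
    intro m
    have p2 : 0 < Real.Gamma (α * m + 1) := Real.Gamma_pos_of_pos (by positivity)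
    have h1 : ∫ s in (0:ℝ)..t, (t - s) ^ (α - 1) *
        ((-ν * s ^ α) ^ m / Real.Gamma (α * m + 1)) =
        ∫ s in (0:ℝ)..t, (-ν) ^ m / Real.Gamma (α * m + 1) *
          ((t - s) ^ (α - 1) * s ^ (α * m + 1 - 1)) := by
      refine intervalIntegral.integral_congr fun s hs => ?_
      rw [uIcc_of_le ht.le] at hs
      rw [ml_term α ν s m hs.1]
      ring
    have e : α * ((m + 1 : ℕ) : ℝ) + 1 = α * m + 1 + α := by push_cast; ring
    have p3 : 0 < Real.Gamma (α * m + 1 + α) := Real.Gamma_pos_of_pos (by positivity)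
    have hp : t ^ (α * m + 1 + α - 1) = (t ^ α) ^ (m + 1) := by
      rw [← Real.rpow_natCast, ← Real.rpow_mul ht.le]
      congr 1
      push_cast
      ring
    rw [h1, intervalIntegral.integral_const_mul, beta_real _ _ _ (by positivity) hα ht, e, hp,
      mul_pow, pow_succ (-ν)]
    field_simp
  simp_rw [hterm] at hS
  have hs := ml_summable α (-ν * t ^ α) hα
  have h0 := hs.tsum_eq_zero_add
  rw [← hS.tsum_eq, tsum_mul_left]
  unfold mittagLeffler
  rw [h0]
  simp only [pow_zero, Nat.cast_zero, mul_zero, zero_add, Real.Gamma_one, div_one]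
  field_simp
  ring

/-- Let `0 < α < 1`, `λ > 0`, `μ > 0`, `T > 0`, `ν = μ/(1+λ)`. If
`u(t) = f/μ + C E_{α,1}(−ν t^α)` satisfies `u(0) = 0` and `u(T) = 0`, then
`C = 0`, `f = 0`, and `u ≡ 0` on `[0,T]`. -/
theorem inverse_problem_uniqueness (α lam μ T C f : ℝ)
    (hα : 0 < α) (hα1 : α < 1) (hlam : 0 < lam) (hμ : 0 < μ) (hT : 0 < T)
    (u : ℝ → ℝ)
    (hu : ∀ t : ℝ, u t = f / μ + C * mittagLeffler α 1 (-(μ / (1 + lam)) * t ^ α))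
    (h0 : u 0 = 0) (hTc : u T = 0) :
    C = 0 ∧ f = 0 ∧ ∀ t ∈ Set.Icc (0:ℝ) T, u t = 0 := by
  have hν : 0 < μ / (1 + lam) := by positivity
  have g0 : mittagLeffler α 1 (-(μ / (1 + lam)) * (0:ℝ) ^ α) = 1 := by
    rw [Real.zero_rpow hα.ne', mul_zero, mittagLeffler, tsum_eq_single 0]
    · simp
    · intro m hm
      simp [hm]
  have hne := no_return α (μ / (1 + lam) / Real.Gamma α) T hα hα1
    (div_pos hν (Real.Gamma_pos_of_pos hα)) hT
    (fun t : ℝ => mittagLeffler α 1 (-(μ / (1 + lam)) * t ^ α))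
    (ml_continuousOn α _ T hα hν) g0 (fun t ht _ => ml_volterra α _ t hα hν ht)
  rw [hu, g0] at h0
  rw [hu] at hTc
  have hC : C = 0 := by
    have : C * (mittagLeffler α 1 (-(μ / (1 + lam)) * T ^ α) - 1) = 0 := by linarith
    rcases mul_eq_zero.1 this with h | h
    · exact h
    · exact absurd (sub_eq_zero.1 h) hne
  subst hC
  have hf : f = 0 := by
    have : f / μ = 0 := by linarith
    rcases div_eq_zero_iff.1 this with h | h
    · exact h
    · exact absurd h hμ.ne'
  subst hf
  exact ⟨rfl, rfl, fun t _ => by rw [hu]; simp⟩
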